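/- The following hold: (i) if w ∈ A0_xy then ((F0)²)_{w,x} = 2q^i − q − 2; (ii) if w ∈ A+_xy then ((F+)²)_{w,x} = q·[n−k] − q^i − q; (iii) if w ∈ A−_xy then ((F−)²)_{w,x} = q·[k] − q^i − q. -/

import Mathlib

open scoped Classical

noncomputable section

variable {F V : Type} [Field F] [AddCommGroup V] [Module F V]

/-- `v` covers `u` in the projective geometry `P`. -/
def Covers (u v : Submodule F V) : Prop :=
  u ≤ v ∧ Module.finrank F ↥v = Module.finrank F ↥u + 1

/-- `v` slash-covers `u` (relative to the fixed subspace `y`). -/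
def SlashCovers (y u v : Submodule F V) : Prop :=
  Covers u v ∧ Module.finrank F ↥(v ⊓ y) = Module.finrank F ↥(u ⊓ y) + 1

/-- `v` backslash-covers `u` (relative to the fixed subspace `y`). -/
def BackslashCovers (y u v : Submodule F V) : Prop :=
  Covers u v ∧ Module.finrank F ↥(v ⊓ y) = Module.finrank F ↥(u ⊓ y)

/-- `q` raised to a real exponent, as a complex number. -/
def qpow (q : ℕ) (e : ℝ) : ℂ := (((q : ℝ) ^ e : ℝ) : ℂ)

/-- The Gaussian bracket `[m] = (q^m - 1)/(q - 1)` as a rational number. -/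
def gaussQ (q m : ℕ) : ℚ := ((q : ℚ) ^ m - 1) / ((q : ℚ) - 1)

/-- The Gaussian bracket `[m] = (q^m - 1)/(q - 1)` as a complex number. -/
def gaussC (q m : ℕ) : ℂ := ((q : ℂ) ^ m - 1) / ((q : ℂ) - 1)

/-- The diagonal matrix `K1`; the `(u,u)` entry is `q^(k/2 - i)` for `u ∈ P_{i,j}`. -/
def matK1 (q k : ℕ) (y : Submodule F V) : Matrix (Submodule F V) (Submodule F V) ℂ :=
  Matrix.diagonal fun u => qpow q ((k : ℝ) / 2 - (Module.finrank F ↥(u ⊓ y) : ℝ))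

/-- The diagonal matrix `K2`; the `(u,u)` entry is `q^(j - (n-k)/2)` for `u ∈ P_{i,j}`. -/
def matK2 (q n k : ℕ) (y : Submodule F V) : Matrix (Submodule F V) (Submodule F V) ℂ :=
  Matrix.diagonal fun u =>
    qpow q (((Module.finrank F ↥u : ℝ) - (Module.finrank F ↥(u ⊓ y) : ℝ))
      - ((n : ℝ) - (k : ℝ)) / 2)

/-- The 0-1 matrix `L1`; the `(u,v)` entry is `1` iff `v` slash-covers `u`. -/
def matL1 (y : Submodule F V) : Matrix (Submodule F V) (Submodule F V) ℂ :=
  Matrix.of fun u v => if SlashCovers y u v then (1 : ℂ) else 0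

/-- The 0-1 matrix `L2`; the `(u,v)` entry is `1` iff `v` backslash-covers `u`. -/
def matL2 (y : Submodule F V) : Matrix (Submodule F V) (Submodule F V) ℂ :=
  Matrix.of fun u v => if BackslashCovers y u v then (1 : ℂ) else 0

/-- `R1 = L1ᵀ`. -/
def matR1 (y : Submodule F V) : Matrix (Submodule F V) (Submodule F V) ℂ := Matrix.transpose (matL1 y)

/-- `R2 = L2ᵀ`. -/
def matR2 (y : Submodule F V) : Matrix (Submodule F V) (Submodule F V) ℂ := Matrix.transpose (matL2 y)

/-- `R = L1 · R2`. -/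
def matR [Fintype (Submodule F V)] (y : Submodule F V) :
    Matrix (Submodule F V) (Submodule F V) ℂ := matL1 y * matR2 y

/-- `L = R1 · L2`. -/
def matL [Fintype (Submodule F V)] (y : Submodule F V) :
    Matrix (Submodule F V) (Submodule F V) ℂ := matR1 y * matL2 y

/-- The 0-1 matrix `F0`. -/
def matF0 (y : Submodule F V) : Matrix (Submodule F V) (Submodule F V) ℂ :=
  Matrix.of fun u v =>
    if SlashCovers y u (u ⊔ v) ∧ SlashCovers y v (u ⊔ v) ∧
        BackslashCovers y (u ⊓ v) u ∧ BackslashCovers y (u ⊓ v) v then (1 : ℂ) else 0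

/-- The 0-1 matrix `F+`. -/
def matFp (y : Submodule F V) : Matrix (Submodule F V) (Submodule F V) ℂ :=
  Matrix.of fun u v =>
    if BackslashCovers y u (u ⊔ v) ∧ BackslashCovers y v (u ⊔ v) then (1 : ℂ) else 0

/-- The 0-1 matrix `F-`. -/
def matFm (y : Submodule F V) : Matrix (Submodule F V) (Submodule F V) ℂ :=
  Matrix.of fun u v =>
    if SlashCovers y (u ⊓ v) u ∧ SlashCovers y (u ⊓ v) v then (1 : ℂ) else 0

/-- The vertex set `X` of the Grassmann graph: `k`-dimensional subspaces of `V`. -/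
abbrev GrassVertex (F V : Type) [Field F] [AddCommGroup V] [Module F V] (k : ℕ) :=
  {z : Submodule F V // Module.finrank F ↥z = k}

/-- The Grassmann graph `J_q(n,k)`: vertices are adjacent iff their intersection
has dimension `k - 1`. -/
def Grass (F V : Type) [Field F] [AddCommGroup V] [Module F V] (k : ℕ) :
    SimpleGraph (GrassVertex F V k) :=
  SimpleGraph.fromRel fun a b => Module.finrank F ↥(a.1 ⊓ b.1) = k - 1

/-- `B_xy = {z ∈ Γ(x) : ∂(z,y) = ∂(x,y) + 1}`. -/
def Bset {k : ℕ} (x y : GrassVertex F V k) : Set (GrassVertex F V k) :=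
  {z | (Grass F V k).Adj x z ∧ (Grass F V k).dist z y = (Grass F V k).dist x y + 1}

/-- `C_xy = {z ∈ Γ(x) : ∂(z,y) = ∂(x,y) - 1}`. -/
def Cset {k : ℕ} (x y : GrassVertex F V k) : Set (GrassVertex F V k) :=
  {z | (Grass F V k).Adj x z ∧ (Grass F V k).dist z y = (Grass F V k).dist x y - 1}

/-- `A_xy = {z ∈ Γ(x) : ∂(z,y) = ∂(x,y)}`. -/
def Aset {k : ℕ} (x y : GrassVertex F V k) : Set (GrassVertex F V k) :=
  {z | (Grass F V k).Adj x z ∧ (Grass F V k).dist z y = (Grass F V k).dist x y}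

/-- `A0_xy`. -/
def A0set {k : ℕ} (x y : GrassVertex F V k) : Set (GrassVertex F V k) :=
  {z | (Grass F V k).Adj x z ∧
    SlashCovers y.1 z.1 (z.1 ⊔ x.1) ∧ SlashCovers y.1 x.1 (z.1 ⊔ x.1) ∧
    BackslashCovers y.1 (z.1 ⊓ x.1) z.1 ∧ BackslashCovers y.1 (z.1 ⊓ x.1) x.1}

/-- `A+_xy`. -/
def Apset {k : ℕ} (x y : GrassVertex F V k) : Set (GrassVertex F V k) :=
  {z | (Grass F V k).Adj x z ∧
    BackslashCovers y.1 z.1 (z.1 ⊔ x.1) ∧ BackslashCovers y.1 x.1 (z.1 ⊔ x.1)}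

/-- `A-_xy`. -/
def Amset {k : ℕ} (x y : GrassVertex F V k) : Set (GrassVertex F V k) :=
  {z | (Grass F V k).Adj x z ∧
    SlashCovers y.1 (z.1 ⊓ x.1) z.1 ∧ SlashCovers y.1 (z.1 ⊓ x.1) x.1}

/-- The edge `wz` has type `0`. -/
def EdgeType0 {k : ℕ} (y w z : GrassVertex F V k) : Prop :=
  SlashCovers y.1 w.1 (w.1 ⊔ z.1) ∧ SlashCovers y.1 z.1 (w.1 ⊔ z.1) ∧
  BackslashCovers y.1 (w.1 ⊓ z.1) w.1 ∧ BackslashCovers y.1 (w.1 ⊓ z.1) z.1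

/-- The edge `wz` has type `+`. -/
def EdgeTypeP {k : ℕ} (y w z : GrassVertex F V k) : Prop :=
  BackslashCovers y.1 w.1 (w.1 ⊔ z.1) ∧ BackslashCovers y.1 z.1 (w.1 ⊔ z.1)

/-- The edge `wz` has type `-`. -/
def EdgeTypeM {k : ℕ} (y w z : GrassVertex F V k) : Prop :=
  SlashCovers y.1 (w.1 ⊓ z.1) w.1 ∧ SlashCovers y.1 (w.1 ⊓ z.1) z.1

/-! ### Counting covers -/

section Counting

variable [FiniteDimensional F V]

theorem card_covers_le [Fintype F] [Fintype (Submodule F V)] {H E : Submodule F V} (h : H ≤ E) :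
    (Finset.univ.filter fun z : Submodule F V => Covers H z ∧ z ≤ E).card =
      ∑ j ∈ Finset.range (Module.finrank F E - Module.finrank F H), Fintype.card F ^ j := by
  have : Finite V := Module.finite_of_finite F
  have : Fintype V := Fintype.ofFinite V
  have hcard (S : Submodule F V) :
      (Finset.univ.filter fun v : V => v ∈ S).card = Fintype.card F ^ Module.finrank F S := by
    rw [← Module.card_eq_pow_finrank (K := F) (V := S), Fintype.card_subtype]
  have hsd {A B : Submodule F V} (hAB : A ≤ B) :
      (Finset.univ.filter fun v : V => v ∈ B ∧ v ∉ A).card + Fintype.card F ^ Module.finrank F A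
        = Fintype.card F ^ Module.finrank F B := by
    rw [← hcard A, ← hcard B, ← Finset.card_union_of_disjoint]
    · congr 1
      ext v
      have := @hAB v
      simp only [Finset.mem_union, Finset.mem_filter, Finset.mem_univ, true_and]
      tauto
    · rw [Finset.disjoint_left]
      intro v
      simp
  have hfib := Finset.card_eq_sum_card_fiberwise
    (f := fun v : V => H ⊔ Submodule.span F {v})
    (s := Finset.univ.filter fun v : V => v ∈ E ∧ v ∉ H)
    (t := Finset.univ.filter fun z : Submodule F V => Covers H z ∧ z ≤ E) (by
      intro v hv
      simp only [Finset.coe_filter, Finset.mem_univ, true_and, Set.mem_ofPred_eq] at hv ⊢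
      refine ⟨⟨le_sup_left, Submodule.finrank_sup_span_singleton hv.2⟩, sup_le h ?_⟩
      rw [Submodule.span_singleton_le_iff_mem]
      exact hv.1)
  rw [Finset.sum_congr rfl (g := fun _ => (Fintype.card F - 1) *
    Fintype.card F ^ Module.finrank F H), Finset.sum_const, smul_eq_mul] at hfib
  · have hE := hsd h
    rw [hfib] at hE
    obtain ⟨m, hm⟩ := Nat.exists_eq_add_of_le (Submodule.finrank_mono h)
    have hq : 1 < Fintype.card F := Fintype.one_lt_card
    rw [hm, Nat.add_sub_cancel_left]
    rw [hm] at hE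
    generalize (Finset.univ.filter fun z : Submodule F V => Covers H z ∧ z ≤ E).card = N at *
    have hpos : 0 < Fintype.card F ^ Module.finrank F H := by positivity
    have h1 : N * (Fintype.card F - 1) + 1 = Fintype.card F ^ m := by
      apply Nat.eq_of_mul_eq_mul_right hpos
      rw [← pow_add, add_comm m, ← hE]
      ring
    have h2 := Nat.geomSum_eq hq m
    rw [h2, ← h1, Nat.add_sub_cancel, Nat.mul_div_cancel _ (by omega)]
  · intro z hz
    simp only [Finset.mem_filter, Finset.mem_univ, true_and] at hz
    obtain ⟨⟨hHz, hdim⟩, hzE⟩ := hz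
    have := hsd hHz
    have heq : ((Finset.univ.filter fun v : V => v ∈ E ∧ v ∉ H).filter
        fun v => H ⊔ Submodule.span F {v} = z) =
        Finset.univ.filter fun v : V => v ∈ z ∧ v ∉ H := by
      ext v
      simp only [Finset.mem_filter, Finset.mem_univ, true_and]
      constructor
      · rintro ⟨⟨-, hv⟩, rfl⟩
        exact ⟨Submodule.mem_sup_right (Submodule.mem_span_singleton_self v), hv⟩
      · rintro ⟨hvz, hv⟩
        refine ⟨⟨hzE hvz, hv⟩, Submodule.eq_of_le_of_finrank_eq (sup_le hHz ?_) ?_⟩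
        · rwa [Submodule.span_singleton_le_iff_mem]
        · rw [Submodule.finrank_sup_span_singleton hv, hdim]
    rw [heq, Nat.sub_mul, one_mul]
    rw [hdim, pow_succ, mul_comm] at this
    omega

/-- Taking annihilators, as a bijection from the subspaces of `V` to those of its dual. -/
def annihilatorEquiv (F V : Type) [Field F] [AddCommGroup V] [Module F V]
    [FiniteDimensional F V] : Submodule F V ≃ Submodule F (Module.Dual F V) where
  toFun W := W.dualAnnihilator
  invFun W := W.dualCoannihilator
  left_inv _ := Subspace.dualAnnihilator_dualCoannihilator_eq
  right_inv _ := Subspace.dualCoannihilator_dualAnnihilator_eq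

theorem finrank_annihilatorEquiv (W : Submodule F V) :
    Module.finrank F W + Module.finrank F (annihilatorEquiv F V W) = Module.finrank F V :=
  Subspace.finrank_add_finrank_dualAnnihilator_eq W

theorem annihilatorEquiv_le_iff {W W' : Submodule F V} :
    annihilatorEquiv F V W ≤ annihilatorEquiv F V W' ↔ W' ≤ W :=
  Subspace.dualAnnihilator_le_dualAnnihilator_iff

theorem annihilatorEquiv_inf (W W' : Submodule F V) :
    annihilatorEquiv F V (W ⊓ W') = annihilatorEquiv F V W ⊔ annihilatorEquiv F V W' :=
  Subspace.dualAnnihilator_inf_eq W W'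

theorem annihilatorEquiv_sup (W W' : Submodule F V) :
    annihilatorEquiv F V (W ⊔ W') = annihilatorEquiv F V W ⊓ annihilatorEquiv F V W' :=
  Submodule.dualAnnihilator_sup_eq W W'

theorem covers_annihilatorEquiv_iff {u v : Submodule F V} :
    Covers (annihilatorEquiv F V v) (annihilatorEquiv F V u) ↔ Covers u v := by
  have hu := finrank_annihilatorEquiv u
  have hv := finrank_annihilatorEquiv v
  unfold Covers
  rw [annihilatorEquiv_le_iff]
  constructor <;> rintro ⟨h, h'⟩ <;> exact ⟨h, by omega⟩

theorem card_covered_ge [Fintype F] [Fintype (Submodule F V)] {D U : Submodule F V} (h : D ≤ U) :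
    (Finset.univ.filter fun z : Submodule F V => Covers z U ∧ D ≤ z).card =
      ∑ j ∈ Finset.range (Module.finrank F U - Module.finrank F D), Fintype.card F ^ j := by
  have : Fintype (Submodule F (Module.Dual F V)) := Fintype.ofEquiv _ (annihilatorEquiv F V)
  have hD := finrank_annihilatorEquiv D
  have hU := finrank_annihilatorEquiv U
  have key := card_covers_le (annihilatorEquiv_le_iff.2 h)
  rw [show Module.finrank F U - Module.finrank F D =
    Module.finrank F (annihilatorEquiv F V D) - Module.finrank F (annihilatorEquiv F V U) by omega,
    ← key]
  refine Finset.card_equiv (annihilatorEquiv F V) fun z => ?_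
  simp only [Finset.mem_filter, Finset.mem_univ, true_and, covers_annihilatorEquiv_iff,
    annihilatorEquiv_le_iff]

end Counting

theorem card_filter_not_and_not {α : Type*} (s : Finset α) (p r : α → Prop) :
    ((s.filter fun a => ¬ p a ∧ ¬ r a).card : ℤ) =
      s.card - (s.filter p).card - (s.filter r).card + (s.filter fun a => p a ∧ r a).card := by
  simp only [Finset.card_filter, Finset.card_eq_sum_ones s, Nat.cast_sum,
    ← Finset.sum_sub_distrib, ← Finset.sum_add_distrib]
  refine Finset.sum_congr rfl fun a _ => ?_
  by_cases hp : p a <;> by_cases hr : r a <;> simp [hp, hr]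

theorem card_filter_not_and_not_and_not {α : Type*} (s : Finset α) (p r t : α → Prop) :
    ((s.filter fun a => ¬ p a ∧ ¬ r a ∧ ¬ t a).card : ℤ) =
      s.card - (s.filter p).card - (s.filter r).card - (s.filter t).card
        + (s.filter fun a => p a ∧ r a).card + (s.filter fun a => p a ∧ t a).card
        + (s.filter fun a => r a ∧ t a).card - (s.filter fun a => p a ∧ r a ∧ t a).card := by
  simp only [Finset.card_filter, Finset.card_eq_sum_ones s, Nat.cast_sum,
    ← Finset.sum_sub_distrib, ← Finset.sum_add_distrib]
  refine Finset.sum_congr rfl fun a _ => ?_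
  by_cases hp : p a <;> by_cases hr : r a <;> by_cases ht : t a <;> simp [hp, hr, ht]

/-! ### Distance in the Grassmann graph -/

section Distance

theorem Grass.adj_iff {k : ℕ} {a b : GrassVertex F V k} :
    (Grass F V k).Adj a b ↔ a ≠ b ∧ Module.finrank F ↥(a.1 ⊓ b.1) = k - 1 := by
  rw [Grass, SimpleGraph.fromRel_adj, inf_comm b.1, or_self]

variable [FiniteDimensional F V]

theorem Grass.finrank_inf_le_of_adj {k : ℕ} (hk : 1 ≤ k) {a b y : GrassVertex F V k}
    (h : (Grass F V k).Adj a b) :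
    Module.finrank F ↥(b.1 ⊓ y.1) ≤ Module.finrank F ↥(a.1 ⊓ y.1) + 1 := by
  rw [Grass.adj_iff] at h
  have h1 := Submodule.finrank_sup_add_finrank_inf_eq (a.1 ⊓ b.1) (b.1 ⊓ y.1)
  have h2 : Module.finrank F ↥((a.1 ⊓ b.1) ⊔ (b.1 ⊓ y.1)) ≤ Module.finrank F b.1 :=
    Submodule.finrank_mono (sup_le inf_le_right inf_le_left)
  have h3 : Module.finrank F ↥((a.1 ⊓ b.1) ⊓ (b.1 ⊓ y.1)) ≤ Module.finrank F ↥(a.1 ⊓ y.1) :=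
    Submodule.finrank_mono (le_inf (inf_le_left.trans inf_le_left) (inf_le_right.trans inf_le_right))
  have := b.2
  omega

theorem Grass.le_finrank_inf_add_length {k : ℕ} (hk : 1 ≤ k) {x y : GrassVertex F V k}
    (p : (Grass F V k).Walk x y) : k ≤ Module.finrank F ↥(x.1 ⊓ y.1) + p.length := by
  induction p with
  | @nil a => rw [inf_idem, a.2]; simp
  | @cons a b c h p ih =>
    have := Grass.finrank_inf_le_of_adj hk (y := c) h
    rw [SimpleGraph.Walk.length_cons]
    omega

theorem Grass.exists_adj_finrank_inf [Finite F] {k : ℕ} (hk : 1 ≤ k) {x y : GrassVertex F V k}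
    (h : Module.finrank F ↥(x.1 ⊓ y.1) < k) :
    ∃ z, (Grass F V k).Adj x z ∧
      Module.finrank F ↥(z.1 ⊓ y.1) = Module.finrank F ↥(x.1 ⊓ y.1) + 1 := by
  have := Fintype.ofFinite F
  have : Finite V := Module.finite_of_finite F
  have := Fintype.ofFinite (Submodule F V)
  have hx := x.2
  have hy := y.2
  have hsum : 0 < ∑ j ∈ Finset.range (k - Module.finrank F ↥(x.1 ⊓ y.1)), Fintype.card F ^ j :=
    Finset.sum_pos (fun _ _ => pow_pos Fintype.card_pos _) (by simp; omega)
  have hA := card_covered_ge (inf_le_left : x.1 ⊓ y.1 ≤ x.1)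
  have hB := card_covers_le (inf_le_right : x.1 ⊓ y.1 ≤ y.1)
  rw [hx] at hA
  rw [hy] at hB
  rw [← hA, Finset.card_pos] at hsum
  obtain ⟨A, hAm⟩ := hsum
  have hsum : 0 < (Finset.univ.filter fun z : Submodule F V =>
      Covers (x.1 ⊓ y.1) z ∧ z ≤ y.1).card := by
    rw [hB, ← hA]; exact Finset.card_pos.2 ⟨A, hAm⟩
  obtain ⟨B, hBm⟩ := Finset.card_pos.1 hsum
  simp only [Finset.mem_filter, Finset.mem_univ, true_and] at hAm hBm
  obtain ⟨⟨hAx, hAd⟩, hDA⟩ := hAm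
  obtain ⟨⟨hDB, hBd⟩, hBy⟩ := hBm
  have hAB : A ⊓ B = x.1 ⊓ y.1 :=
    le_antisymm (inf_le_inf hAx hBy) (le_inf hDA hDB)
  have hdim := Submodule.finrank_sup_add_finrank_inf_eq A B
  rw [hAB] at hdim
  let z : GrassVertex F V k := ⟨A ⊔ B, by omega⟩
  have hzy : Module.finrank F B ≤ Module.finrank F ↥(z.1 ⊓ y.1) :=
    Submodule.finrank_mono (le_inf le_sup_right hBy)
  have hxz : Module.finrank F A ≤ Module.finrank F ↥(x.1 ⊓ z.1) :=
    Submodule.finrank_mono (le_inf hAx le_sup_left)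
  have hne : x ≠ z := by
    rintro hxz'
    rw [← hxz'] at hzy
    omega
  have hlt : Module.finrank F ↥(x.1 ⊓ z.1) < k := by
    by_contra hge
    have h1 : x.1 ⊓ z.1 = x.1 := Submodule.eq_of_le_of_finrank_le inf_le_left (by omega)
    exact hne (Subtype.ext (Submodule.eq_of_le_of_finrank_eq (inf_eq_left.1 h1)
      (by rw [x.2, z.2])))
  have hadj : (Grass F V k).Adj x z := Grass.adj_iff.2 ⟨hne, by omega⟩
  have := Grass.finrank_inf_le_of_adj hk (y := y) hadj
  exact ⟨z, hadj, by omega⟩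

theorem Grass.exists_walk_length [Finite F] {k : ℕ} (hk : 1 ≤ k) {y : GrassVertex F V k}
    (m : ℕ) (x : GrassVertex F V k) (h : Module.finrank F ↥(x.1 ⊓ y.1) + m = k) :
    ∃ p : (Grass F V k).Walk x y, p.length = m := by
  induction m generalizing x with
  | zero =>
    have h1 : x.1 ⊓ y.1 = x.1 :=
      Submodule.eq_of_le_of_finrank_eq inf_le_left (by rw [x.2]; omega)
    obtain rfl : x = y := Subtype.ext
      (Submodule.eq_of_le_of_finrank_eq (inf_eq_left.1 h1) (by rw [x.2, y.2]))
    exact ⟨.nil, rfl⟩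
  | succ m ih =>
    obtain ⟨z, hxz, hz⟩ := Grass.exists_adj_finrank_inf hk (x := x) (y := y) (by omega)
    obtain ⟨p, hp⟩ := ih z (by omega)
    exact ⟨.cons hxz p, by rw [SimpleGraph.Walk.length_cons, hp]⟩

theorem Grass.finrank_inf_add_dist [Finite F] {k : ℕ} (hk : 1 ≤ k) (x y : GrassVertex F V k) :
    Module.finrank F ↥(x.1 ⊓ y.1) + (Grass F V k).dist x y = k := by
  have hle : Module.finrank F ↥(x.1 ⊓ y.1) ≤ Module.finrank F x.1 :=
    Submodule.finrank_mono inf_le_left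
  rw [x.2] at hle
  obtain ⟨p, hp⟩ := Grass.exists_walk_length hk (y := y) (k - Module.finrank F ↥(x.1 ⊓ y.1)) x (by omega)
  have h1 := SimpleGraph.dist_le p
  obtain ⟨p', hp'⟩ := p.reachable.exists_walk_length_eq_dist
  have h2 := Grass.le_finrank_inf_add_length hk p'
  omega

end Distance

/-! ### The three relations -/

/-- The relation on subspaces encoded by the matrix `F0`. -/
def ZeroRel (y u v : Submodule F V) : Prop :=
  SlashCovers y u (u ⊔ v) ∧ SlashCovers y v (u ⊔ v) ∧
    BackslashCovers y (u ⊓ v) u ∧ BackslashCovers y (u ⊓ v) v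

/-- The relation on subspaces encoded by the matrix `F+`. -/
def PlusRel (y u v : Submodule F V) : Prop :=
  BackslashCovers y u (u ⊔ v) ∧ BackslashCovers y v (u ⊔ v)

/-- The relation on subspaces encoded by the matrix `F-`. -/
def MinusRel (y u v : Submodule F V) : Prop :=
  SlashCovers y (u ⊓ v) u ∧ SlashCovers y (u ⊓ v) v

theorem ZeroRel.symm {y u v : Submodule F V} (h : ZeroRel y u v) : ZeroRel y v u := by
  unfold ZeroRel at *
  rw [sup_comm v u, inf_comm v u]
  tauto

theorem PlusRel.symm {y u v : Submodule F V} (h : PlusRel y u v) : PlusRel y v u := by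
  unfold PlusRel at *
  rw [sup_comm v u]
  tauto

theorem mul_self_apply_of_rel {α : Type*} [Fintype α] {M : Matrix α α ℂ} {R : α → α → Prop}
    (hM : ∀ u v, M u v = if R u v then 1 else 0) (w x : α) :
    (M * M) w x = ((Finset.univ.filter fun z => R w z ∧ R z x).card : ℤ) := by
  rw [Matrix.mul_apply, Finset.card_filter]
  push_cast
  refine Finset.sum_congr rfl fun z _ => ?_
  by_cases h1 : R w z <;> by_cases h2 : R z x <;> simp [hM, h1, h2]

section Relations

variable [FiniteDimensional F V]

theorem sup_eq_of_covers {x z U : Submodule F V} (hx : Covers x U) (hz : Covers z U)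
    (hne : z ≠ x) : x ⊔ z = U := by
  refine Submodule.eq_of_le_of_finrank_le (sup_le hx.1 hz.1) ?_
  have hlt : x < x ⊔ z := by
    refine lt_of_le_of_ne le_sup_left fun h => hne ?_
    refine Submodule.eq_of_le_of_finrank_eq (sup_eq_left.1 h.symm) ?_
    have := hx.2
    have := hz.2
    omega
  have := Submodule.finrank_lt_finrank_of_lt hlt
  have := hx.2
  omega

theorem inf_eq_of_covers {H x z : Submodule F V} (hx : Covers H x) (hz : Covers H z)
    (hne : ¬ z ≤ x) : x ⊓ z = H := by
  symm
  refine Submodule.eq_of_le_of_finrank_le (le_inf hx.1 hz.1) ?_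
  have hlt : x ⊓ z < z := lt_of_le_of_ne inf_le_right fun h => hne (inf_eq_right.1 h)
  have := Submodule.finrank_lt_finrank_of_lt hlt
  have := hz.2
  omega

theorem covers_inf_of_not_le_sup {m : ℕ} {w x z : Submodule F V} (hw : Module.finrank F w = m)
    (hx : Module.finrank F x = m) (hz : Module.finrank F z = m)
    (hwx : Module.finrank F ↥(w ⊔ x) = m + 1)
    (hwz : Module.finrank F ↥(w ⊔ z) = m + 1) (hxz : Module.finrank F ↥(x ⊔ z) = m + 1)
    (h : ¬ z ≤ w ⊔ x) : Covers (w ⊓ x) z := by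
  have h1 := Submodule.finrank_sup_add_finrank_inf_eq w x
  have h2 := Submodule.finrank_sup_add_finrank_inf_eq w z
  have h3 := Submodule.finrank_sup_add_finrank_inf_eq x z
  have hlt : (w ⊔ x) ⊓ z < z := lt_of_le_of_ne inf_le_right fun h' => h (inf_eq_right.1 h')
  have h4 := Submodule.finrank_lt_finrank_of_lt hlt
  have e1 : w ⊓ z = (w ⊔ x) ⊓ z :=
    Submodule.eq_of_le_of_finrank_le (inf_le_inf_right _ le_sup_left) (by omega)
  have e2 : x ⊓ z = (w ⊔ x) ⊓ z :=
    Submodule.eq_of_le_of_finrank_le (inf_le_inf_right _ le_sup_right) (by omega)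
  have e3 : w ⊓ z = w ⊓ x :=
    Submodule.eq_of_le_of_finrank_le
      (le_inf inf_le_left ((e1.trans e2.symm).le.trans inf_le_left)) (by omega)
  exact ⟨e3.symm.le.trans inf_le_right, by omega⟩

theorem PlusRel.inf_le {y x z : Submodule F V} (h : PlusRel y x z) : x ⊓ y ≤ z := by
  have : z ⊓ y = (x ⊔ z) ⊓ y :=
    Submodule.eq_of_le_of_finrank_eq (inf_le_inf_right _ le_sup_right) h.2.2.symm
  exact (inf_le_inf_right y le_sup_left).trans (this.symm.le.trans inf_le_left)

theorem PlusRel.not_le_sup {y x z : Submodule F V} (h : PlusRel y x z) : ¬ z ≤ x ⊔ y := by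
  intro hz
  have h1 := Submodule.finrank_sup_add_finrank_inf_eq x y
  have h2 := Submodule.finrank_sup_add_finrank_inf_eq (x ⊔ z) y
  rw [show x ⊔ z ⊔ y = x ⊔ y from le_antisymm (sup_le (sup_le le_sup_left hz) le_sup_right)
    (sup_le_sup_right le_sup_left y)] at h2
  have h3 := h.1.2
  have h4 := h.1.1.2
  omega

theorem plusRel_of_covers {y x z U : Submodule F V} (hx : Covers x U) (hz : Covers z U)
    (hne : z ≠ x) (hyx : U ⊓ y ≤ x) (hyz : U ⊓ y ≤ z) : PlusRel y x z := by
  have hU := sup_eq_of_covers hx hz hne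
  rw [PlusRel, hU]
  refine ⟨⟨hx, ?_⟩, ⟨hz, ?_⟩⟩
  · rw [le_antisymm (inf_le_inf_right y hx.1) (le_inf hyx inf_le_right)]
  · rw [le_antisymm (inf_le_inf_right y hz.1) (le_inf hyz inf_le_right)]

theorem plusRel_of_covered {y x z H : Submodule F V} (hx : Covers H x) (hz : Covers H z)
    (hD : x ⊓ y ≤ H) (h : ¬ z ≤ x ⊔ y) : PlusRel y x z := by
  have hH := inf_eq_of_covers hx hz fun h' => h (h'.trans le_sup_left)
  have h1 := Submodule.finrank_sup_add_finrank_inf_eq x z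
  rw [hH] at h1
  have hx2 := hx.2
  have hz2 := hz.2
  have h2 := Submodule.finrank_sup_add_finrank_inf_eq x y
  have h3 := Submodule.finrank_sup_add_finrank_inf_eq (x ⊔ z) y
  have hlt : x ⊔ y < x ⊔ z ⊔ y := lt_of_le_of_ne (sup_le_sup_right le_sup_left y)
    fun h' => h (le_sup_right.trans (le_sup_left.trans h'.symm.le))
  have h4 := Submodule.finrank_lt_finrank_of_lt hlt
  have h5 : Module.finrank F ↥(x ⊓ y) ≤ Module.finrank F ↥(z ⊓ y) :=
    Submodule.finrank_mono (le_inf (hD.trans hz.1) inf_le_right)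
  have h6 : Module.finrank F ↥(z ⊓ y) ≤ Module.finrank F ↥((x ⊔ z) ⊓ y) :=
    Submodule.finrank_mono (inf_le_inf_right y le_sup_right)
  exact ⟨⟨⟨le_sup_left, by omega⟩, by omega⟩, ⟨⟨le_sup_right, by omega⟩, by omega⟩⟩

theorem plusRel_and_plusRel_iff {m : ℕ} {y w x z : Submodule F V}
    (hw : Module.finrank F w = m) (hx : Module.finrank F x = m) (h : PlusRel y w x) :
    PlusRel y w z ∧ PlusRel y z x ↔
      (Covers z (w ⊔ x) ∧ x ⊓ y ≤ z ∧ z ≠ w ∧ z ≠ x) ∨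
      (Covers (w ⊓ x) z ∧ ¬ z ≤ w ⊔ x ∧ ¬ z ≤ w ⊔ y ∧ ¬ z ≤ x ⊔ y) := by
  have hUd := h.1.1.2
  have hyU : (w ⊔ x) ⊓ y = x ⊓ y :=
    (Submodule.eq_of_le_of_finrank_eq (inf_le_inf_right _ le_sup_right) h.2.2.symm).symm
  have hyU' : (w ⊔ x) ⊓ y = w ⊓ y :=
    (Submodule.eq_of_le_of_finrank_eq (inf_le_inf_right _ le_sup_left) h.1.2.symm).symm
  have hH := Submodule.finrank_sup_add_finrank_inf_eq w x
  constructor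
  · rintro ⟨h1, h2⟩
    have h1d := h1.1.1.2
    have h1d' := h1.2.1.2
    have h2d := h2.symm.1.1.2
    by_cases hz : z ≤ w ⊔ x
    · left
      refine ⟨⟨hz, by omega⟩, h2.symm.inf_le, ?_, ?_⟩
      · rintro rfl
        exact h1.not_le_sup le_sup_left
      · rintro rfl
        exact h2.not_le_sup le_sup_left
    · right
      exact ⟨covers_inf_of_not_le_sup hw hx (by omega) (by omega) (by omega) (by omega) hz,
        hz, h1.not_le_sup, h2.symm.not_le_sup⟩
  · rintro (⟨hz, hD, hzw, hzx⟩ | ⟨hz, -, hzw, hzx⟩)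
    · refine ⟨plusRel_of_covers h.1.1 hz hzw ?_ (by rwa [hyU]),
        (plusRel_of_covers h.2.1 hz hzx ?_ (by rwa [hyU])).symm⟩
      · rw [hyU']; exact inf_le_left
      · rw [hyU]; exact inf_le_left
    · refine ⟨plusRel_of_covered ⟨inf_le_left, by omega⟩ hz (le_inf inf_le_left ?_) hzw,
        (plusRel_of_covered ⟨inf_le_right, by omega⟩ hz (le_inf ?_ inf_le_left) hzx).symm⟩
      · rw [← hyU', hyU]; exact inf_le_left
      · rw [← hyU, hyU']; exact inf_le_left

theorem card_plusRel [Fintype F] [Fintype (Submodule F V)] {m i : ℕ} {y w x : Submodule F V}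
    (hw : Module.finrank F w = m) (hx : Module.finrank F x = m) (hy : Module.finrank F y = m)
    (hi : Module.finrank F ↥(x ⊓ y) + i = m) (h : PlusRel y w x) :
    ((Finset.univ.filter fun z => PlusRel y w z ∧ PlusRel y z x).card : ℤ) =
      ((∑ j ∈ Finset.range (Module.finrank F V - m + 1), Fintype.card F ^ j : ℕ) : ℤ)
        - Fintype.card F ^ i - Fintype.card F - 1 := by
  have hUd := h.1.1.2
  have hyU := h.1.2
  have hyU' := h.2.2
  have hwx : w ≠ x := by
    rintro rfl
    rw [sup_idem] at hUd
    omega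
  have hH := Submodule.finrank_sup_add_finrank_inf_eq w x
  have hwy := Submodule.finrank_sup_add_finrank_inf_eq w y
  have hxy := Submodule.finrank_sup_add_finrank_inf_eq x y
  have hU := Submodule.finrank_sup_add_finrank_inf_eq (w ⊔ x) y
  have hDw : x ⊓ y ≤ w := h.symm.inf_le
  have hUw : (w ⊔ x) ⊓ (w ⊔ y) = w := by
    symm
    refine Submodule.eq_of_le_of_finrank_le (le_inf le_sup_left le_sup_left) ?_
    have := Submodule.finrank_sup_add_finrank_inf_eq (w ⊔ x) (w ⊔ y)
    rw [show (w ⊔ x) ⊔ (w ⊔ y) = w ⊔ x ⊔ y by rw [← sup_sup_distrib_left, sup_assoc]] at this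
    omega
  have hUx : (w ⊔ x) ⊓ (x ⊔ y) = x := by
    symm
    refine Submodule.eq_of_le_of_finrank_le (le_inf le_sup_right le_sup_left) ?_
    have := Submodule.finrank_sup_add_finrank_inf_eq (w ⊔ x) (x ⊔ y)
    rw [show (w ⊔ x) ⊔ (x ⊔ y) = w ⊔ x ⊔ y by
      rw [sup_assoc w, ← sup_assoc x x, sup_idem, sup_assoc]] at this
    omega
  have hyy := Submodule.finrank_sup_add_finrank_inf_eq (w ⊔ y) (x ⊔ y)
  rw [← sup_sup_distrib_right] at hyy
  have hHw : w ⊓ x ≤ w := inf_le_left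
  have hHx : w ⊓ x ≤ x := inf_le_right
  have hlines (E : Submodule F V) (hE : w ⊓ x ≤ E) {r : ℕ}
      (hr : Module.finrank F E + 1 = m + r) :
      ((Finset.univ.filter (Covers (w ⊓ x))).filter (· ≤ E)).card =
        ∑ j ∈ Finset.range r, Fintype.card F ^ j := by
    rw [Finset.filter_filter, card_covers_le hE]
    congr 2
    omega
  rw [Finset.filter_congr fun z _ => plusRel_and_plusRel_iff hw hx h, Finset.filter_or,
    Finset.card_union_of_disjoint, Nat.cast_add]
  · have hA := card_covered_ge (inf_le_left.trans le_sup_right : x ⊓ y ≤ w ⊔ x)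
    rw [show Module.finrank F ↥(w ⊔ x) - Module.finrank F ↥(x ⊓ y) = i + 1 by omega] at hA
    have hA' : (Finset.univ.filter fun z : Submodule F V =>
        Covers z (w ⊔ x) ∧ x ⊓ y ≤ z ∧ z ≠ w ∧ z ≠ x) =
        ((Finset.univ.filter fun z : Submodule F V => Covers z (w ⊔ x) ∧ x ⊓ y ≤ z).erase w).erase
          x := by
      ext z
      simp only [Finset.mem_filter, Finset.mem_univ, true_and, Finset.mem_erase]
      tauto
    have hx_mem : x ∈ (Finset.univ.filter fun z : Submodule F V =>
        Covers z (w ⊔ x) ∧ x ⊓ y ≤ z).erase w := by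
      simp [hwx.symm, h.2.1]
    have hw_mem : w ∈ Finset.univ.filter fun z : Submodule F V =>
        Covers z (w ⊔ x) ∧ x ⊓ y ≤ z := by
      simp [h.1.1, hDw]
    have c1 := Finset.card_erase_add_one hx_mem
    have c2 := Finset.card_erase_add_one hw_mem
    rw [← hA'] at c1
    rw [hA, Finset.sum_range_succ] at c2
    rw [← Finset.filter_filter (Covers (w ⊓ x)), card_filter_not_and_not_and_not]
    simp only [← le_inf_iff]
    have t0 := hlines ⊤ le_top (r := Module.finrank F V - m + 1) (by
      have := Submodule.finrank_le x
      rw [finrank_top]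
      omega)
    simp only [le_top, Finset.filter_true] at t0
    have t1 := hlines (w ⊔ x) (hHw.trans le_sup_left) (r := 2) (by omega)
    have t2 := hlines (w ⊔ y) (hHw.trans le_sup_left) (r := i + 1) (by omega)
    have t3 := hlines (x ⊔ y) (hHx.trans le_sup_left) (r := i + 1) (by omega)
    have t4 := hlines ((w ⊔ x) ⊓ (w ⊔ y)) (hHw.trans hUw.symm.le) (r := 1) (by rw [hUw]; omega)
    have t5 := hlines ((w ⊔ x) ⊓ (x ⊔ y)) (hHx.trans hUx.symm.le) (r := 1) (by rw [hUx]; omega)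
    have t6 := hlines ((w ⊔ y) ⊓ (x ⊔ y))
      (le_inf (hHw.trans le_sup_left) (hHx.trans le_sup_left)) (r := i) (by omega)
    have e7 : (w ⊔ x) ⊓ ((w ⊔ y) ⊓ (x ⊔ y)) = w ⊓ x := by
      rw [inf_inf_distrib_left, hUw, hUx]
    have t7 := hlines ((w ⊔ x) ⊓ ((w ⊔ y) ⊓ (x ⊔ y))) e7.symm.le (r := 0) (by rw [e7]; omega)
    rw [t0, t1, t2, t3, t4, t5, t6, t7]
    simp only [Finset.sum_range_succ, Finset.sum_range_zero] at c1 c2 ⊢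
    push_cast
    zify at c1 c2
    linarith
  · rw [Finset.disjoint_left]
    intro z h1 h2
    simp only [Finset.mem_filter, Finset.mem_univ, true_and] at h1 h2
    exact h2.2.1 h1.1.1

theorem ZeroRel.inf_le {y x z : Submodule F V} (h : ZeroRel y x z) : x ⊓ y ≤ z := by
  have : x ⊓ z ⊓ y = x ⊓ y :=
    Submodule.eq_of_le_of_finrank_eq (inf_le_inf_right _ inf_le_left) h.2.2.1.2.symm
  exact this.symm.le.trans (inf_le_left.trans inf_le_right)

theorem ZeroRel.le_sup {y x z : Submodule F V} (h : ZeroRel y x z) : z ≤ x ⊔ y := by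
  have h1 := Submodule.finrank_sup_add_finrank_inf_eq x y
  have h2 := Submodule.finrank_sup_add_finrank_inf_eq (x ⊔ z) y
  have h3 := h.1.2
  have h4 := h.1.1.2
  have : x ⊔ y = x ⊔ z ⊔ y :=
    Submodule.eq_of_le_of_finrank_eq (sup_le_sup_right le_sup_left y) (by omega)
  exact le_sup_right.trans (le_sup_left.trans this.symm.le)

theorem ZeroRel.not_sup_inf_le {y x z : Submodule F V} (h : ZeroRel y x z) :
    ¬ (x ⊔ z) ⊓ y ≤ x := by
  intro hle
  have h1 : Module.finrank F ↥((x ⊔ z) ⊓ y) ≤ Module.finrank F ↥(x ⊓ y) :=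
    Submodule.finrank_mono (le_inf hle inf_le_right)
  have := h.1.2
  omega

theorem ZeroRel.not_le_inf_sup {y x z : Submodule F V} (h : ZeroRel y x z) :
    ¬ z ≤ x ⊓ z ⊔ y := by
  intro hle
  have h1 := Submodule.finrank_sup_add_finrank_inf_eq z y
  have h2 := Submodule.finrank_sup_add_finrank_inf_eq (x ⊓ z) y
  have h3 : Module.finrank F ↥(z ⊔ y) ≤ Module.finrank F ↥(x ⊓ z ⊔ y) :=
    Submodule.finrank_mono (sup_le hle le_sup_right)
  have := h.2.2.2.2
  have := h.2.2.2.1.2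
  omega

theorem zeroRel_of_covers {y x z U : Submodule F V} (hx : Covers x U) (hz : Covers z U)
    (hne : z ≠ x) (hD : x ⊓ y ≤ z) (hyx : ¬ U ⊓ y ≤ x) (hyz : ¬ U ⊓ y ≤ z) : ZeroRel y x z := by
  have hU := sup_eq_of_covers hx hz hne
  have h1 := Submodule.finrank_sup_add_finrank_inf_eq x z
  have h2 := Submodule.finrank_sup_add_finrank_inf_eq x (U ⊓ y)
  have h3 : Module.finrank F ↥(x ⊔ U ⊓ y) ≤ Module.finrank F U :=
    Submodule.finrank_mono (sup_le hx.1 inf_le_left)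
  rw [show x ⊓ (U ⊓ y) = x ⊓ y by rw [← inf_assoc, inf_eq_left.2 hx.1]] at h2
  rw [hU] at h1
  have hlt (t : Submodule F V) (ht : t ≤ U) (hty : ¬ U ⊓ y ≤ t) :
      Module.finrank F ↥(t ⊓ y) < Module.finrank F ↥(U ⊓ y) :=
    Submodule.finrank_lt_finrank_of_lt (lt_of_le_of_ne (inf_le_inf_right y ht)
      fun h => hty (h.symm.le.trans inf_le_left))
  have h4 := hlt x hx.1 hyx
  have h5 := hlt z hz.1 hyz
  have h6 : Module.finrank F ↥(x ⊓ y) ≤ Module.finrank F ↥(x ⊓ z ⊓ y) :=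
    Submodule.finrank_mono (le_inf (le_inf inf_le_left hD) inf_le_right)
  have h7 : Module.finrank F ↥(x ⊓ z ⊓ y) ≤ Module.finrank F ↥(z ⊓ y) :=
    Submodule.finrank_mono (inf_le_inf_right y inf_le_right)
  have hx2 := hx.2
  have hz2 := hz.2
  rw [ZeroRel, hU]
  exact ⟨⟨hx, by omega⟩, ⟨hz, by omega⟩, ⟨⟨inf_le_left, by omega⟩, by omega⟩,
    ⟨⟨inf_le_right, by omega⟩, by omega⟩⟩

theorem zeroRel_of_covered {y x z H : Submodule F V} (hx : Covers H x) (hz : Covers H z)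
    (hD : x ⊓ y ≤ H) (hzy : z ≤ x ⊔ y) (hzx : ¬ z ≤ x) (hzH : ¬ z ≤ H ⊔ y) : ZeroRel y x z := by
  have hH := inf_eq_of_covers hx hz hzx
  have hHy : H ⊓ y = x ⊓ y := le_antisymm (inf_le_inf_right y hx.1) (le_inf hD inf_le_right)
  have h1 := Submodule.finrank_sup_add_finrank_inf_eq x z
  have h2 := Submodule.finrank_sup_add_finrank_inf_eq (x ⊔ z) y
  have h3 := Submodule.finrank_sup_add_finrank_inf_eq x y
  have h4 := Submodule.finrank_sup_add_finrank_inf_eq H y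
  have h5 := Submodule.finrank_sup_add_finrank_inf_eq z y
  rw [show x ⊔ z ⊔ y = x ⊔ y from le_antisymm (sup_le (sup_le le_sup_left hzy) le_sup_right)
    (sup_le_sup_right le_sup_left y)] at h2
  have hlt : H ⊔ y < z ⊔ y := lt_of_le_of_ne (sup_le_sup_right hz.1 y)
    fun h => hzH (le_sup_left.trans h.symm.le)
  have h6 := Submodule.finrank_lt_finrank_of_lt hlt
  have h7 : Module.finrank F ↥(H ⊓ y) ≤ Module.finrank F ↥(z ⊓ y) :=
    Submodule.finrank_mono (inf_le_inf_right y hz.1)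
  rw [hHy] at h4 h7
  rw [hH] at h1
  have hx2 := hx.2
  have hz2 := hz.2
  rw [ZeroRel, hH, SlashCovers, SlashCovers, BackslashCovers, BackslashCovers, hHy]
  exact ⟨⟨⟨le_sup_left, by omega⟩, by omega⟩, ⟨⟨le_sup_right, by omega⟩, by omega⟩, ⟨hx, rfl⟩,
    ⟨hz, by omega⟩⟩

theorem zeroRel_and_zeroRel_iff {m : ℕ} {y w x z : Submodule F V}
    (hw : Module.finrank F w = m) (hx : Module.finrank F x = m) (h : ZeroRel y w x) :
    ZeroRel y w z ∧ ZeroRel y z x ↔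
      ((Covers z (w ⊔ x) ∧ x ⊓ y ≤ z ∧ ¬ (w ⊔ x) ⊓ y ≤ z) ∧ z ≠ w ∧ z ≠ x) ∨
      ((Covers (w ⊓ x) z ∧ z ≤ x ⊔ y) ∧ ¬ z ≤ w ⊔ x ∧ ¬ z ≤ w ⊓ x ⊔ y) := by
  have hUd := h.1.1.2
  have hwxy : w ⊓ y = x ⊓ y :=
    le_antisymm (le_inf h.inf_le inf_le_right) (le_inf h.symm.inf_le inf_le_right)
  have hwxy' : w ⊔ y = x ⊔ y :=
    le_antisymm (sup_le h.symm.le_sup le_sup_right) (sup_le h.le_sup le_sup_right)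
  constructor
  · rintro ⟨h1, h2⟩
    have h1d := h1.1.1.2
    have h1d' := h1.2.1.1.2
    have h2d := h2.symm.1.1.2
    have hzw : z ≠ w := by
      rintro rfl
      rw [sup_idem] at h1d
      omega
    have hzx : z ≠ x := by
      rintro rfl
      rw [sup_idem] at h2d
      omega
    by_cases hz : z ≤ w ⊔ x
    · left
      have hzU : Covers z (w ⊔ x) := ⟨hz, by omega⟩
      refine ⟨⟨hzU, h2.symm.inf_le, ?_⟩, hzw, hzx⟩
      have := h1.symm.not_sup_inf_le
      rwa [sup_comm z, sup_eq_of_covers h.1.1 hzU hzw] at this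
    · right
      have hHz := covers_inf_of_not_le_sup hw hx (by omega) (by omega) (by omega) (by omega) hz
      refine ⟨⟨hHz, h2.symm.le_sup⟩, hz, ?_⟩
      have := h1.not_le_inf_sup
      rwa [inf_eq_of_covers h.2.2.1.1 hHz fun h' => hz (h'.trans le_sup_left)] at this
  · rintro (⟨⟨hz, hD, hUz⟩, hzw, hzx⟩ | ⟨⟨hz, hzy⟩, hzU, hzH⟩)
    · refine ⟨zeroRel_of_covers h.1.1 hz hzw (by rwa [hwxy]) h.not_sup_inf_le hUz,
        (zeroRel_of_covers h.2.1.1 hz hzx hD ?_ hUz).symm⟩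
      rw [sup_comm w]
      exact h.symm.not_sup_inf_le
    · refine ⟨zeroRel_of_covered h.2.2.1.1 hz (le_inf inf_le_left h.inf_le) (by rwa [hwxy'])
          (fun h' => hzU (h'.trans le_sup_left)) hzH,
        (zeroRel_of_covered h.2.2.2.1 hz (le_inf h.symm.inf_le inf_le_left) hzy
          (fun h' => hzU (h'.trans le_sup_right)) hzH).symm⟩

theorem card_zeroRel [Fintype F] [Fintype (Submodule F V)] {m i : ℕ} {y w x : Submodule F V}
    (hw : Module.finrank F w = m) (hx : Module.finrank F x = m) (hy : Module.finrank F y = m)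
    (hi : Module.finrank F ↥(x ⊓ y) + i = m) (h : ZeroRel y w x) :
    ((Finset.univ.filter fun z => ZeroRel y w z ∧ ZeroRel y z x).card : ℤ) =
      2 * Fintype.card F ^ i - Fintype.card F - 2 := by
  have hUd := h.1.1.2
  have hUy := h.2.1.2
  have hHd := h.2.2.1.1.2
  have hHy := h.2.2.2.2
  have hwx : w ≠ x := by
    rintro rfl
    rw [sup_idem] at hUd
    omega
  have hxy := Submodule.finrank_sup_add_finrank_inf_eq x y
  have hUs := Submodule.finrank_sup_add_finrank_inf_eq (w ⊔ x) y
  have hHs := Submodule.finrank_sup_add_finrank_inf_eq (w ⊓ x) y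
  have hUH := Submodule.finrank_sup_add_finrank_inf_eq (w ⊔ x) (w ⊓ x ⊔ y)
  have hUxy : w ⊔ x ⊔ y = x ⊔ y :=
    le_antisymm (sup_le (sup_le h.symm.le_sup le_sup_left) le_sup_right)
      (sup_le_sup_right le_sup_right y)
  rw [hUxy] at hUs
  rw [← sup_assoc, sup_eq_left.2 (inf_le_left.trans le_sup_left : w ⊓ x ≤ w ⊔ x), hUxy] at hUH
  have hHU : w ⊓ x ≤ w ⊔ x := inf_le_left.trans le_sup_left
  have hHxy : w ⊓ x ≤ x ⊔ y := inf_le_right.trans le_sup_left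
  have hlines (E : Submodule F V) (hE : w ⊓ x ≤ E) (hExy : E ≤ x ⊔ y) {r : ℕ}
      (hr : Module.finrank F E + 1 = m + r) :
      ((Finset.univ.filter fun z => Covers (w ⊓ x) z ∧ z ≤ x ⊔ y).filter (· ≤ E)).card =
        ∑ j ∈ Finset.range r, Fintype.card F ^ j := by
    rw [Finset.filter_filter, Finset.filter_congr (q := fun z => Covers (w ⊓ x) z ∧ z ≤ E),
      card_covers_le hE]
    · congr 2
      omega
    · exact fun z _ => ⟨fun hz => ⟨hz.1.1, hz.2⟩, fun hz => ⟨⟨hz.1, hz.2.trans hExy⟩, hz.2⟩⟩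
  rw [Finset.filter_congr fun z _ => zeroRel_and_zeroRel_iff hw hx h, Finset.filter_or,
    Finset.card_union_of_disjoint, Nat.cast_add]
  · have hA := card_covered_ge (inf_le_left.trans le_sup_right : x ⊓ y ≤ w ⊔ x)
    rw [show Module.finrank F ↥(w ⊔ x) - Module.finrank F ↥(x ⊓ y) = i + 1 by omega] at hA
    have hB := card_covered_ge (inf_le_left : (w ⊔ x) ⊓ y ≤ w ⊔ x)
    rw [show Module.finrank F ↥(w ⊔ x) - Module.finrank F ↥((w ⊔ x) ⊓ y) = i by omega] at hB
    have hAB := Finset.card_filter_add_card_filter_not (s := Finset.univ.filter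
      fun z : Submodule F V => Covers z (w ⊔ x) ∧ x ⊓ y ≤ z) (fun z => (w ⊔ x) ⊓ y ≤ z)
    rw [Finset.filter_filter, Finset.filter_filter,
      Finset.filter_congr (q := fun z => Covers z (w ⊔ x) ∧ (w ⊔ x) ⊓ y ≤ z), hA, hB,
      Finset.sum_range_succ] at hAB
    rotate_left
    · exact fun z _ => ⟨fun hz => ⟨hz.1.1, hz.2⟩,
        fun hz => ⟨⟨hz.1, (inf_le_inf_right y le_sup_right).trans hz.2⟩, hz.2⟩⟩
    simp only [and_assoc] at hAB
    have hA' : (Finset.univ.filter fun z : Submodule F V =>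
        (Covers z (w ⊔ x) ∧ x ⊓ y ≤ z ∧ ¬ (w ⊔ x) ⊓ y ≤ z) ∧ z ≠ w ∧ z ≠ x) =
        ((Finset.univ.filter fun z : Submodule F V =>
          Covers z (w ⊔ x) ∧ x ⊓ y ≤ z ∧ ¬ (w ⊔ x) ⊓ y ≤ z).erase w).erase x := by
      ext z
      simp only [Finset.mem_filter, Finset.mem_univ, true_and, Finset.mem_erase]
      tauto
    have hx_mem : x ∈ (Finset.univ.filter fun z : Submodule F V =>
        Covers z (w ⊔ x) ∧ x ⊓ y ≤ z ∧ ¬ (w ⊔ x) ⊓ y ≤ z).erase w := by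
      rw [Finset.mem_erase, Finset.mem_filter]
      refine ⟨hwx.symm, Finset.mem_univ _, h.2.1.1, inf_le_left, ?_⟩
      rw [sup_comm]
      exact h.symm.not_sup_inf_le
    have hw_mem : w ∈ Finset.univ.filter fun z : Submodule F V =>
        Covers z (w ⊔ x) ∧ x ⊓ y ≤ z ∧ ¬ (w ⊔ x) ⊓ y ≤ z := by
      rw [Finset.mem_filter]
      exact ⟨Finset.mem_univ _, h.1.1, h.symm.inf_le, h.not_sup_inf_le⟩
    have c1 := Finset.card_erase_add_one hx_mem
    have c2 := Finset.card_erase_add_one hw_mem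
    rw [← hA'] at c1
    rw [← Finset.filter_filter (fun z => Covers (w ⊓ x) z ∧ z ≤ x ⊔ y), card_filter_not_and_not]
    simp only [← le_inf_iff]
    have t0 := card_covers_le hHxy
    rw [show Module.finrank F ↥(x ⊔ y) - Module.finrank F ↥(w ⊓ x) = i + 1 by omega] at t0
    have t1 := hlines (w ⊔ x) hHU (hUxy ▸ le_sup_left) (r := 2) (by omega)
    have t2 := hlines (w ⊓ x ⊔ y) le_sup_left (sup_le hHxy le_sup_right) (r := i) (by omega)
    have t3 := hlines ((w ⊔ x) ⊓ (w ⊓ x ⊔ y)) (le_inf hHU le_sup_left)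
      (inf_le_left.trans (hUxy ▸ le_sup_left)) (r := 1) (by omega)
    rw [t0, t1, t2, t3]
    simp only [Finset.sum_range_succ, Finset.sum_range_zero]
    push_cast
    zify at c1 c2 hAB
    linarith
  · rw [Finset.disjoint_left]
    intro z h1 h2
    simp only [Finset.mem_filter, Finset.mem_univ, true_and] at h1 h2
    exact h2.2.1 h1.1.1.1

theorem backslashCovers_annihilatorEquiv_iff {y u v : Submodule F V} :
    BackslashCovers (annihilatorEquiv F V y) (annihilatorEquiv F V v) (annihilatorEquiv F V u) ↔
      SlashCovers y u v := by
  unfold BackslashCovers SlashCovers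
  rw [covers_annihilatorEquiv_iff, ← annihilatorEquiv_sup, ← annihilatorEquiv_sup]
  refine and_congr_right fun h => ?_
  have h1 := finrank_annihilatorEquiv (u ⊔ y)
  have h2 := finrank_annihilatorEquiv (v ⊔ y)
  have h3 := Submodule.finrank_sup_add_finrank_inf_eq u y
  have h4 := Submodule.finrank_sup_add_finrank_inf_eq v y
  have := h.2
  omega

theorem plusRel_annihilatorEquiv_iff {y u v : Submodule F V} :
    PlusRel (annihilatorEquiv F V y) (annihilatorEquiv F V u) (annihilatorEquiv F V v) ↔
      MinusRel y u v := by
  rw [PlusRel, MinusRel, ← annihilatorEquiv_inf, backslashCovers_annihilatorEquiv_iff,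
    backslashCovers_annihilatorEquiv_iff]

theorem card_minusRel [Fintype F] [Fintype (Submodule F V)] {m i : ℕ} {y w x : Submodule F V}
    (hw : Module.finrank F w = m) (hx : Module.finrank F x = m) (hy : Module.finrank F y = m)
    (hi : Module.finrank F ↥(x ⊓ y) + i = m) (h : MinusRel y w x) :
    ((Finset.univ.filter fun z => MinusRel y w z ∧ MinusRel y z x).card : ℤ) =
      ((∑ j ∈ Finset.range (m + 1), Fintype.card F ^ j : ℕ) : ℤ)
        - Fintype.card F ^ i - Fintype.card F - 1 := by
  have : Fintype (Submodule F (Module.Dual F V)) := Fintype.ofEquiv _ (annihilatorEquiv F V)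
  have h1 := finrank_annihilatorEquiv w
  have h2 := finrank_annihilatorEquiv x
  have h3 := finrank_annihilatorEquiv y
  have h4 := finrank_annihilatorEquiv (x ⊔ y)
  have h5 := Submodule.finrank_sup_add_finrank_inf_eq x y
  rw [annihilatorEquiv_sup] at h4
  have key := card_plusRel (m := Module.finrank F V - m) (i := i) (by omega) (by omega) (by omega)
    (by omega) (plusRel_annihilatorEquiv_iff.2 h)
  rw [Subspace.dual_finrank_eq, show Module.finrank F V - (Module.finrank F V - m) = m by omega]
    at key
  rw [← key]
  congr 1
  refine Finset.card_equiv (annihilatorEquiv F V) fun z => ?_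
  simp only [Finset.mem_filter, Finset.mem_univ, true_and, plusRel_annihilatorEquiv_iff]

end Relations

theorem geom_sum_succ_sub_one {q : ℕ} (hq : 1 < q) (r : ℕ) :
    ((∑ j ∈ Finset.range (r + 1), q ^ j : ℕ) : ℂ) - 1 = q * gaussC q r := by
  have h1 : (q : ℂ) ≠ 1 := by exact_mod_cast hq.ne'
  have h2 := geom_sum_succ (x := (q : ℂ)) (n := r)
  rw [geom_sum_eq h1 r] at h2
  push_cast
  rw [h2, gaussC]
  ring

theorem statement16
    (q n k : ℕ) (hq : IsPrimePow q) (hkn : 2 * k < n) (hk : 3 ≤ k)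
    (F V : Type) [Field F] [Fintype F] (hcard : Fintype.card F = q)
    [AddCommGroup V] [Module F V] [FiniteDimensional F V]
    (hdim : Module.finrank F V = n)
    [Fintype (Submodule F V)]
    (x y : GrassVertex F V k)
    (i : ℕ) (hi : (Grass F V k).dist x y = i) (hi1 : 1 < i) (hi2 : i < k) :
    (∀ w ∈ A0set x y, (matF0 y.1 * matF0 y.1) w.1 x.1 = 2 * (q : ℂ) ^ i - q - 2) ∧
    (∀ w ∈ Apset x y,
      (matFp y.1 * matFp y.1) w.1 x.1 = (q : ℂ) * gaussC q (n - k) - (q : ℂ) ^ i - q) ∧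
    (∀ w ∈ Amset x y,
      (matFm y.1 * matFm y.1) w.1 x.1 = (q : ℂ) * gaussC q k - (q : ℂ) ^ i - q) := by
  subst hcard
  have hd := Grass.finrank_inf_add_dist (by omega : 1 ≤ k) x y
  rw [hi] at hd
  refine ⟨fun w hw => ?_, fun w hw => ?_, fun w hw => ?_⟩
  · rw [mul_self_apply_of_rel (M := matF0 y.1) (R := ZeroRel y.1)
      (fun _ _ => if_congr Iff.rfl rfl rfl),
      card_zeroRel w.2 x.2 y.2 hd hw.2]
    push_cast
    ring
  · rw [mul_self_apply_of_rel (M := matFp y.1) (R := PlusRel y.1)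
      (fun _ _ => if_congr Iff.rfl rfl rfl),
      card_plusRel w.2 x.2 y.2 hd hw.2, hdim, ← geom_sum_succ_sub_one Fintype.one_lt_card]
    push_cast
    ring
  · rw [mul_self_apply_of_rel (M := matFm y.1) (R := MinusRel y.1)
      (fun _ _ => if_congr Iff.rfl rfl rfl),
      card_minusRel w.2 x.2 y.2 hd hw.2, ← geom_sum_succ_sub_one Fintype.one_lt_card]
    push_cast
    ring
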